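/- The invariant ring R₂^{GL₂(F_q)} equals the F_q-subalgebra of R₂ generated by the seven polynomials {d₂₂^{q−1}, c₂₁, (d₂₂*)^{q−1}, c₂₁*, u₁*, u₀, u₁}. -/

import Mathlib

open MvPolynomial

noncomputable section

abbrev R2 (F : Type) [Field F] : Type := MvPolynomial (Fin 4) F

/-- The action of `A ∈ GL₂(F)` on `R₂ = F[x₁,x₂,y₁,y₂]` (variables `X 0, X 1, X 2, X 3`). -/
def act {F : Type} [Field F] (A : GL (Fin 2) F) : R2 F →ₐ[F] R2 F :=
  aeval ![C ((A.val.det)⁻¹ * A.val 1 1) * X 0 - C ((A.val.det)⁻¹ * A.val 1 0) * X 1,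
          C ((A.val.det)⁻¹ * A.val 0 0) * X 1 - C ((A.val.det)⁻¹ * A.val 0 1) * X 0,
          C (A.val 0 0) * X 2 + C (A.val 0 1) * X 3,
          C (A.val 1 0) * X 2 + C (A.val 1 1) * X 3]

/-- The invariant ring `R₂^G` for a subgroup `G ≤ GL₂(F)`. -/
def invariantRing {F : Type} [Field F] (G : Subgroup (GL (Fin 2) F)) : Subalgebra F (R2 F) where
  carrier := {f | ∀ A ∈ G, act A f = f}
  mul_mem' := fun hf hg A hA => by rw [map_mul, hf A hA, hg A hA]
  add_mem' := fun hf hg A hA => by rw [map_add, hf A hA, hg A hA]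
  one_mem' := fun A _ => map_one (act A)
  zero_mem' := fun A _ => map_zero (act A)
  algebraMap_mem' := fun r A _ => (act A).commutes r

/-- `SL₂(F)` as a subgroup of `GL₂(F)`. -/
def SL2 (F : Type) [Field F] : Subgroup (GL (Fin 2) F) where
  carrier := {A | A.val.det = 1}
  one_mem' := by simp
  mul_mem' := by
    intro a b ha hb
    simp only [Set.mem_setOf_eq, Units.val_mul, Matrix.det_mul] at *
    rw [ha, hb, mul_one]
  inv_mem' := by
    intro a ha
    have h : ((a⁻¹).val * a.val).det = 1 := by
      rw [← Units.val_mul, inv_mul_cancel, Units.val_one, Matrix.det_one]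
    simp only [Matrix.det_mul] at h
    rw [Set.mem_setOf_eq] at ha ⊢
    rw [ha, mul_one] at h
    exact h

/-- `P₂(F)`: upper triangular matrices in `SL₂(F)` with 1's on the diagonal. -/
def P2 (F : Type) [Field F] : Subgroup (GL (Fin 2) F) where
  carrier := {A | A.val 0 0 = 1 ∧ A.val 1 1 = 1 ∧ A.val 1 0 = 0}
  one_mem' := by simp
  mul_mem' := by
    intro a b ha hb
    obtain ⟨ha1, ha2, ha3⟩ := ha
    obtain ⟨hb1, hb2, hb3⟩ := hb
    refine ⟨?_, ?_, ?_⟩ <;>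
      simp [Units.val_mul, Matrix.mul_apply, Fin.sum_univ_two, ha1, ha2, ha3, hb1, hb2, hb3]
  inv_mem' := by
    intro a ha
    obtain ⟨ha1, ha2, ha3⟩ := ha
    have hdet : a.val.det = 1 := by
      rw [Matrix.det_fin_two, ha1, ha2, ha3]; ring
    have hinv : (a⁻¹).val = a.val⁻¹ := by
      simp [Matrix.coe_units_inv]
    refine ⟨?_, ?_, ?_⟩ <;>
      simp [hinv, Matrix.inv_def, hdet, Matrix.adjugate_fin_two, ha1, ha2, ha3]

def d22 (F : Type) [Field F] (q : ℕ) : R2 F := X 1 * X 0 ^ q - X 0 * X 1 ^ q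
def d22s (F : Type) [Field F] (q : ℕ) : R2 F := X 2 * X 3 ^ q - X 3 * X 2 ^ q
def u0 (F : Type) [Field F] : R2 F := X 0 * X 2 + X 1 * X 3
def u1 (F : Type) [Field F] (q : ℕ) : R2 F := X 0 ^ q * X 2 + X 1 ^ q * X 3
def u1s (F : Type) [Field F] (q : ℕ) : R2 F := X 0 * X 2 ^ q + X 1 * X 3 ^ q
def phi1 (F : Type) [Field F] : R2 F := X 0
def phi2 (F : Type) [Field F] (q : ℕ) : R2 F := X 1 ^ q - X 1 * X 0 ^ (q - 1)
def phi1s (F : Type) [Field F] : R2 F := X 3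
def phi2s (F : Type) [Field F] (q : ℕ) : R2 F := X 2 ^ q - X 2 * X 3 ^ (q - 1)

section Abstract

variable {F R : Type*} [Field F] [CommRing R] [Algebra F R]

theorem eq_zero_of_sum_mul_eq_zero_of_conjugates [IsDomain R] {Γ ι : Type*} [Fintype Γ] [Fintype ι]
    (C : Subalgebra F R) (τ : Γ → R →ₐ[F] R) (hτ : ∀ g, ∀ c ∈ C, τ g c = c) (t : R)
    (ht : Function.Injective fun g => τ g t) (hcard : Fintype.card ι = Fintype.card Γ)
    (m : ι → R) (hspan : ∀ k : ℕ, t ^ k ∈ Submodule.span C (Set.range m))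
    (a : ι → R) (ha : ∀ i, a i ∈ C) (h0 : ∑ i, a i * m i = 0) : ∀ i, a i = 0 := by
  classical
  let g : ι ≃ Γ := Fintype.equivOfCardEq hcard
  let r : Fin (Fintype.card ι) ≃ ι := (Fintype.equivFin ι).symm
  choose b hb using fun k => (Submodule.mem_span_range_iff_exists_fun C).1 (hspan k)
  let W : Matrix (Fin (Fintype.card ι)) (Fin (Fintype.card ι)) R :=
    fun i j => τ (g (r i)) (m (r j))
  let B : Matrix (Fin (Fintype.card ι)) (Fin (Fintype.card ι)) R := fun j k => b k (r j)
  have hV : Matrix.vandermonde (fun i => τ (g (r i)) t) = W * B := by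
    ext i k
    rw [Matrix.vandermonde_apply, ← map_pow, ← hb k, map_sum, Matrix.mul_apply, ← r.sum_comp]
    refine Finset.sum_congr rfl fun j _ => ?_
    rw [Subalgebra.smul_def, smul_eq_mul, map_mul, hτ _ _ (b k (r j)).2, mul_comm]
  have hdet : W.det ≠ 0 := by
    have := Matrix.det_vandermonde_ne_zero_iff.2
      ((ht.comp g.injective).comp r.injective)
    intro hW
    apply this
    change (Matrix.vandermonde (fun i => τ (g (r i)) t)).det = 0
    rw [hV, Matrix.det_mul, hW, zero_mul]
  have hz := Matrix.eq_zero_of_mulVec_eq_zero hdet (v := fun j => a (r j)) (by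
    ext i
    have := congrArg (τ (g (r i))) h0
    rw [map_sum, map_zero, ← r.sum_comp] at this
    rw [Matrix.mulVec, dotProduct, Pi.zero_apply, ← this]
    refine Finset.sum_congr rfl fun j _ => ?_
    rw [map_mul, hτ _ _ (ha (r j)), mul_comm])
  intro i
  simpa using congrFun hz (r.symm i)

/-- The monomials `x ^ i * z ^ j` below the degrees of the monic equations of `x` and `z`. -/
def dicksonMonomial (q : ℕ) (x z : R) (i : Fin (q ^ 2 - 1) × Fin (q ^ 2 - q)) : R :=
  x ^ (i.1 : ℕ) * z ^ (i.2 : ℕ)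

theorem mul_mem_span_of_mem {C : Subalgebra F R} {s : Set R} {a m : R} (ha : a ∈ C)
    (hm : m ∈ Submodule.span C s) : a * m ∈ Submodule.span C s :=
  Submodule.smul_mem _ (⟨a, ha⟩ : C) hm

theorem pow_mul_pow_mem_span_dicksonMonomial {q : ℕ} (hq : 2 ≤ q) {C : Subalgebra F R}
    {x z e c : R} (he : e ∈ C) (hc : c ∈ C) (hx : x ^ (q ^ 2 - 1) = c * x ^ (q - 1) - e)
    (hz : c = ∑ i ∈ Finset.range (q + 1), (z ^ (q - 1)) ^ i * (x ^ (q - 1)) ^ (q - i))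
    (j i : ℕ) : x ^ i * z ^ j ∈ Submodule.span C (Set.range (dicksonMonomial q x z)) := by
  have hlt : q - 1 < q ^ 2 - 1 := by have : q < q ^ 2 := by nlinarith
                                     omega
  have hqq : (q - 1) * q = q ^ 2 - q := by rw [Nat.sub_mul, sq, one_mul]
  induction j using Nat.strong_induction_on generalizing i with
  | _ j ihj =>
  induction i using Nat.strong_induction_on with
  | _ i ihi =>
  by_cases h1 : q ^ 2 - 1 ≤ i
  · obtain ⟨i, rfl⟩ := Nat.exists_eq_add_of_le h1
    have : x ^ (q ^ 2 - 1 + i) * z ^ j =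
        c * (x ^ (q - 1 + i) * z ^ j) - e * (x ^ i * z ^ j) := by
      rw [pow_add, hx]; ring
    rw [this]
    exact sub_mem (mul_mem_span_of_mem hc (ihi _ (by omega)))
      (mul_mem_span_of_mem he (ihi _ (by omega)))
  by_cases h2 : q ^ 2 - q ≤ j
  · obtain ⟨j, rfl⟩ := Nat.exists_eq_add_of_le h2
    rw [Finset.sum_range_succ, ← pow_mul z (q - 1) q, hqq, Nat.sub_self, pow_zero, mul_one] at hz
    have : x ^ i * z ^ (q ^ 2 - q + j) = c * (x ^ i * z ^ j) - ∑ l ∈ Finset.range q,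
        x ^ ((q - 1) * (q - l) + i) * z ^ ((q - 1) * l + j) := by
      have h3 : z ^ (q ^ 2 - q) = c - ∑ l ∈ Finset.range q,
          (z ^ (q - 1)) ^ l * (x ^ (q - 1)) ^ (q - l) := by linear_combination -hz
      rw [pow_add, h3, sub_mul, mul_sub, Finset.sum_mul, Finset.mul_sum]
      congr 1
      · ring
      · refine Finset.sum_congr rfl fun l _ => ?_
        rw [pow_add, pow_add, pow_mul, pow_mul]; ring
    rw [this]
    refine sub_mem (mul_mem_span_of_mem hc (ihj _ ?_ _)) (sum_mem fun l hl => ihj _ ?_ _)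
    · have : q < q ^ 2 := by nlinarith
      omega
    · have : (q - 1) * l < (q - 1) * q :=
        Nat.mul_lt_mul_of_pos_left (Finset.mem_range.1 hl) (by omega)
      omega
  · exact Submodule.subset_span ⟨(⟨i, by omega⟩, ⟨j, by omega⟩), rfl⟩

/-- The monomials in `u, v, w` that are not leading monomials of the defining relations. -/
def pairingMonomial (k : ℕ) (u v w : R) :
    (Fin (k * (k + 3) + 1) × Fin (k + 2) × Fin (k + 2)) ⊕ Fin (k + 2) → R :=
  Sum.elim (fun i => u ^ (i.1 : ℕ) * v ^ (i.2.1 : ℕ) * w ^ (i.2.2 : ℕ))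
    (fun i => u ^ (k * (k + 3) + 1 + i))

theorem pow_mul_pow_mul_pow_mem_span_pairingMonomial {k : ℕ} {C : Subalgebra F R}
    {u v w e c es cs : R} (he : e ∈ C) (hc : c ∈ C) (hes : es ∈ C) (hcs : cs ∈ C)
    (hv : v ^ (k + 2) = c * u ^ (k + 2) - e * w)
    (hw : w ^ (k + 2) = cs * u ^ (k + 2) - es * v)
    (hu : u ^ ((k + 3) * (k + 1)) =
      e * es - ∑ i ∈ Finset.range (k + 1), (v * w) ^ (i + 1) * (u ^ (k + 3)) ^ (k - i))
    (huv : u ^ (k * (k + 3) + 1) * v = e * cs - c * w ^ (k + 1) -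
      ∑ i ∈ Finset.range k, u * v * ((v * w) ^ (i + 1) * (u ^ (k + 3)) ^ (k - (i + 1))))
    (huw : u ^ (k * (k + 3) + 1) * w = es * c - cs * v ^ (k + 1) -
      ∑ i ∈ Finset.range k, u * w * ((v * w) ^ (i + 1) * (u ^ (k + 3)) ^ (k - (i + 1))))
    (i j l : ℕ) :
    u ^ i * v ^ j * w ^ l ∈ Submodule.span C (Set.range (pairingMonomial k u v w)) := by
  induction hn : 4 * i + 5 * j + 5 * l using Nat.strong_induction_on generalizing i j l with
  | _ n ih =>
  subst hn
  replace ih : ∀ i' j' l', 4 * i' + 5 * j' + 5 * l' < 4 * i + 5 * j + 5 * l →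
      u ^ i' * v ^ j' * w ^ l' ∈ Submodule.span C (Set.range (pairingMonomial k u v w)) :=
    fun i' j' l' h => ih _ h i' j' l' rfl
  by_cases hj : k + 2 ≤ j
  · obtain ⟨j, rfl⟩ := Nat.exists_eq_add_of_le hj
    have : u ^ i * v ^ (k + 2 + j) * w ^ l =
        c * (u ^ (k + 2 + i) * v ^ j * w ^ l) - e * (u ^ i * v ^ j * w ^ (l + 1)) := by
      rw [pow_add, hv]; ring
    rw [this]
    exact sub_mem (mul_mem_span_of_mem hc (ih _ _ _ (by omega)))
      (mul_mem_span_of_mem he (ih _ _ _ (by omega)))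
  by_cases hl : k + 2 ≤ l
  · obtain ⟨l, rfl⟩ := Nat.exists_eq_add_of_le hl
    have : u ^ i * v ^ j * w ^ (k + 2 + l) =
        cs * (u ^ (k + 2 + i) * v ^ j * w ^ l) - es * (u ^ i * v ^ (j + 1) * w ^ l) := by
      rw [pow_add, hw]; ring
    rw [this]
    exact sub_mem (mul_mem_span_of_mem hcs (ih _ _ _ (by omega)))
      (mul_mem_span_of_mem hes (ih _ _ _ (by omega)))
  by_cases hi : (k + 3) * (k + 1) ≤ i
  · obtain ⟨i, rfl⟩ := Nat.exists_eq_add_of_le hi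
    have : u ^ ((k + 3) * (k + 1) + i) * v ^ j * w ^ l =
        e * (es * (u ^ i * v ^ j * w ^ l)) - ∑ m ∈ Finset.range (k + 1),
          u ^ ((k + 3) * (k - m) + i) * v ^ (m + 1 + j) * w ^ (m + 1 + l) := by
      rw [pow_add, hu, sub_mul, sub_mul, sub_mul, Finset.sum_mul, Finset.sum_mul, Finset.sum_mul]
      congr 1
      · ring
      · refine Finset.sum_congr rfl fun m _ => ?_
        rw [mul_pow, ← pow_mul]; ring
    rw [this]
    refine sub_mem (mul_mem_span_of_mem he (mul_mem_span_of_mem hes (ih _ _ _ ?_)))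
      (sum_mem fun m hm => ih _ _ _ ?_)
    · nlinarith
    · obtain ⟨r, rfl⟩ := Nat.exists_eq_add_of_le (Finset.mem_range_succ_iff.1 hm)
      rw [Nat.add_sub_cancel_left]
      nlinarith [Nat.zero_le (m * m), Nat.zero_le (m * r)]
  by_cases hi' : k * (k + 3) + 1 ≤ i
  · rcases Nat.eq_zero_or_pos j with rfl | hj0
    · rcases Nat.eq_zero_or_pos l with rfl | hl0
      · obtain ⟨i, rfl⟩ := Nat.exists_eq_add_of_le hi'
        rw [pow_zero, pow_zero, mul_one, mul_one]
        exact Submodule.subset_span ⟨Sum.inr ⟨i, by nlinarith⟩, rfl⟩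
      · obtain ⟨i, rfl⟩ := Nat.exists_eq_add_of_le hi'
        obtain ⟨l, rfl⟩ := Nat.exists_eq_add_of_le' hl0
        have : u ^ (k * (k + 3) + 1 + i) * v ^ 0 * w ^ (l + 1) =
            es * (c * (u ^ i * v ^ 0 * w ^ l)) - cs * (u ^ i * v ^ (k + 1) * w ^ l) -
            ∑ m ∈ Finset.range k,
              u ^ ((k + 3) * (k - (m + 1)) + 1 + i) * v ^ (m + 1) * w ^ (m + 2 + l) := by
          have h3 : u ^ (k * (k + 3) + 1 + i) * v ^ 0 * w ^ (l + 1) =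
            (u ^ (k * (k + 3) + 1) * w) * (u ^ i * w ^ l) := by ring
          rw [h3, huw, sub_mul, sub_mul, Finset.sum_mul]
          congr 1
          · ring
          · refine Finset.sum_congr rfl fun m _ => ?_
            rw [mul_pow, ← pow_mul]; ring
        rw [this]
        refine sub_mem (sub_mem (mul_mem_span_of_mem hes (mul_mem_span_of_mem hc (ih _ _ _ ?_)))
          (mul_mem_span_of_mem hcs (ih _ _ _ ?_))) (sum_mem fun m hm => ih _ _ _ ?_)
        · nlinarith
        · nlinarith
        · obtain ⟨r, rfl⟩ := Nat.exists_eq_add_of_le (Nat.succ_le_of_lt (Finset.mem_range.1 hm))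
          rw [Nat.add_sub_cancel_left]
          nlinarith [Nat.zero_le (m * m), Nat.zero_le (m * r)]
    · obtain ⟨i, rfl⟩ := Nat.exists_eq_add_of_le hi'
      obtain ⟨j, rfl⟩ := Nat.exists_eq_add_of_le' hj0
      have : u ^ (k * (k + 3) + 1 + i) * v ^ (j + 1) * w ^ l =
          e * (cs * (u ^ i * v ^ j * w ^ l)) - c * (u ^ i * v ^ j * w ^ (k + 1 + l)) -
          ∑ m ∈ Finset.range k,
            u ^ ((k + 3) * (k - (m + 1)) + 1 + i) * v ^ (m + 2 + j) * w ^ (m + 1 + l) := by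
        have h3 : u ^ (k * (k + 3) + 1 + i) * v ^ (j + 1) * w ^ l =
          (u ^ (k * (k + 3) + 1) * v) * (u ^ i * v ^ j * w ^ l) := by ring
        rw [h3, huv, sub_mul, sub_mul, Finset.sum_mul]
        congr 1
        · ring
        · refine Finset.sum_congr rfl fun m _ => ?_
          rw [mul_pow, ← pow_mul]; ring
      rw [this]
      refine sub_mem (sub_mem (mul_mem_span_of_mem he (mul_mem_span_of_mem hcs (ih _ _ _ ?_)))
        (mul_mem_span_of_mem hc (ih _ _ _ ?_))) (sum_mem fun m hm => ih _ _ _ ?_)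
      · nlinarith
      · nlinarith
      · obtain ⟨r, rfl⟩ := Nat.exists_eq_add_of_le (Nat.succ_le_of_lt (Finset.mem_range.1 hm))
        rw [Nat.add_sub_cancel_left]
        nlinarith [Nat.zero_le (m * m), Nat.zero_le (m * r)]
  · exact Submodule.subset_span
      ⟨Sum.inl (⟨i, by omega⟩, ⟨j, by omega⟩, ⟨l, by omega⟩), rfl⟩

end Abstract

section Relations

variable {F R : Type*} [Field F] [CommRing R] [Algebra F R]

theorem mul_mem_span_range {ι : Type*} {C : Subalgebra F R} {m : ι → R} {a n : R}
    (ha : ∀ i, a * m i ∈ Submodule.span C (Set.range m))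
    (hn : n ∈ Submodule.span C (Set.range m)) : a * n ∈ Submodule.span C (Set.range m) := by
  induction hn using Submodule.span_induction with
  | mem x hx => obtain ⟨i, rfl⟩ := hx; exact ha i
  | zero => rw [mul_zero]; exact zero_mem _
  | add x y _ _ hx hy => rw [mul_add]; exact add_mem hx hy
  | smul r x _ hx => rw [mul_smul_comm]; exact Submodule.smul_mem _ r hx

theorem mem_of_mem_adjoin {C : Subalgebra F R} {N : Submodule C R} (h1 : 1 ∈ N) {T : Set R}
    (hT : ∀ t ∈ T, ∀ n ∈ N, t * n ∈ N) {f : R} (hf : f ∈ Algebra.adjoin F T) : f ∈ N := by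
  suffices ∀ n ∈ N, f * n ∈ N by simpa using this 1 h1
  induction hf using Algebra.adjoin_induction with
  | mem x hx => exact hT x hx
  | algebraMap r =>
    intro n hn
    rw [← Algebra.smul_def, ← algebraMap_smul C r n]
    exact Submodule.smul_mem _ _ hn
  | add x y _ _ hx hy => intro n hn; rw [add_mul]; exact add_mem (hx n hn) (hy n hn)
  | mul x y _ _ hx hy => intro n hn; rw [mul_assoc]; exact hx _ (hy n hn)

variable [Fintype F]

theorem add_pow_fintypeCard {q : ℕ} (hF : Fintype.card F = q) (a b : R) :
    (a + b) ^ q = a ^ q + b ^ q := by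
  subst hF
  exact map_add (FiniteField.frobeniusAlgHom F R) a b

theorem sub_pow_fintypeCard {q : ℕ} (hF : Fintype.card F = q) (a b : R) :
    (a - b) ^ q = a ^ q - b ^ q := by
  subst hF
  exact map_sub (FiniteField.frobeniusAlgHom F R) a b

variable [IsDomain R]

theorem sub_pow_fintypeCard_sub_one {q : ℕ} (hF : Fintype.card F = q) {a b : R} (hab : a ≠ b) :
    (a - b) ^ (q - 1) = ∑ i ∈ Finset.range q, a ^ i * b ^ (q - 1 - i) := by
  apply mul_right_cancel₀ (sub_ne_zero.2 hab)
  rw [geom_sum₂_mul, ← pow_succ, Nat.sub_add_cancel (hF ▸ Fintype.card_pos),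
    sub_pow_fintypeCard hF]

/-- `t ^ q ^ 2 = c * t ^ q - d ^ (q - 1) * t` for `t = x` and `t = z`. -/
theorem dickson_equation {q : ℕ} (hF : Fintype.card F = q) {x z d c : R}
    (hd : d = z * x ^ q - x * z ^ q) (hd0 : d ≠ 0)
    (hc : d * c = z * x ^ (q ^ 2) - x * z ^ (q ^ 2)) :
    x ^ (q ^ 2) = c * x ^ q - d ^ (q - 1) * x ∧ z ^ (q ^ 2) = c * z ^ q - d ^ (q - 1) * z := by
  have hq : q - 1 + 1 = q := Nat.sub_add_cancel (hF ▸ Fintype.card_pos)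
  have h1 : d * d ^ (q - 1) = z ^ q * x ^ (q ^ 2) - x ^ q * z ^ (q ^ 2) := by
    rw [← pow_succ', hq]
    nth_rewrite 1 [hd]
    rw [sub_pow_fintypeCard hF, mul_pow, mul_pow, ← pow_mul, ← pow_mul, ← sq]
  constructor <;> apply mul_left_cancel₀ hd0
  · linear_combination (x ^ q ^ 2) * hd - x ^ q * hc + x * h1
  · linear_combination (z ^ q ^ 2) * hd - z ^ q * hc + z * h1

theorem dickson_eq_sum {q : ℕ} (hq : 2 ≤ q) {x z d c : R}
    (hd : d = z * x ^ q - x * z ^ q) (hd0 : d ≠ 0)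
    (hc : d * c = z * x ^ (q ^ 2) - x * z ^ (q ^ 2)) :
    c = ∑ i ∈ Finset.range (q + 1), (z ^ (q - 1)) ^ i * (x ^ (q - 1)) ^ (q - i) := by
  obtain ⟨k, rfl⟩ := Nat.exists_eq_add_of_le' hq
  apply mul_left_cancel₀ hd0
  have h := geom_sum₂_mul (z ^ (k + 2 - 1)) (x ^ (k + 2 - 1)) (k + 2 + 1)
  rw [Nat.add_sub_cancel, ← pow_mul, ← pow_mul] at h
  have h1 : (k + 2 - 1) * (k + 2 + 1) + 1 = (k + 2) ^ 2 := by
    rw [show k + 2 - 1 = k + 1 from rfl]; ring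
  have h2 : d = - (x * z * (z ^ (k + 2 - 1) - x ^ (k + 2 - 1))) := by
    rw [hd, show k + 2 - 1 = k + 1 from rfl]; ring
  rw [hc, h2]
  rw [← h1]
  linear_combination x * z * h

variable {q : ℕ} {x₁ x₂ y₁ y₂ d c ds cs u v w : R}

/-- The relations among the pairings `u, v, w` and the Dickson invariants. -/
theorem pairing_relations (hF : Fintype.card F = q)
    (hd : d = x₂ * x₁ ^ q - x₁ * x₂ ^ q) (hd0 : d ≠ 0)
    (hc : d * c = x₂ * x₁ ^ (q ^ 2) - x₁ * x₂ ^ (q ^ 2))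
    (hds : ds = y₁ * y₂ ^ q - y₂ * y₁ ^ q) (hds0 : ds ≠ 0)
    (hcs : ds * cs = y₁ * y₂ ^ (q ^ 2) - y₂ * y₁ ^ (q ^ 2))
    (hu : u = x₁ * y₁ + x₂ * y₂) (hv : v = x₁ ^ q * y₁ + x₂ ^ q * y₂)
    (hw : w = x₁ * y₁ ^ q + x₂ * y₂ ^ q) :
    v ^ q = c * u ^ q - d ^ (q - 1) * w ∧ w ^ q = cs * u ^ q - ds ^ (q - 1) * v ∧
    u ^ (q ^ 2) = c * cs * u ^ q - c * ds ^ (q - 1) * v - cs * d ^ (q - 1) * w +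
      d ^ (q - 1) * ds ^ (q - 1) * u ∧
    d * ds = v * w - u ^ (q + 1) := by
  obtain ⟨hx₁, hx₂⟩ := dickson_equation hF hd hd0 hc
  obtain ⟨hy₂, hy₁⟩ := dickson_equation hF hds hds0 hcs
  have huq : u ^ q = x₁ ^ q * y₁ ^ q + x₂ ^ q * y₂ ^ q := by
    rw [hu, add_pow_fintypeCard hF, mul_pow, mul_pow]
  refine ⟨?_, ?_, ?_, ?_⟩
  · rw [huq, hv, hw, add_pow_fintypeCard hF, mul_pow, mul_pow, ← pow_mul, ← pow_mul, ← sq, hx₁, hx₂]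
    ring
  · rw [huq, hv, hw, add_pow_fintypeCard hF, mul_pow, mul_pow, ← pow_mul, ← pow_mul, ← sq, hy₁, hy₂]
    ring
  · have : u ^ (q ^ 2) = x₁ ^ q ^ 2 * y₁ ^ q ^ 2 + x₂ ^ q ^ 2 * y₂ ^ q ^ 2 := by
      rw [sq, pow_mul, huq, add_pow_fintypeCard hF]; ring
    rw [this, hx₁, hx₂, hy₁, hy₂, huq, hu, hv, hw]
    ring
  · rw [pow_succ, huq, hd, hds, hu, hv, hw]
    ring

/-- The remaining relations; together with those for `v ^ q` and `w ^ q` they rewrite every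
monomial in `u, v, w`. -/
theorem pairing_relations' {k : ℕ} (hF : Fintype.card F = k + 2) {e es : R}
    (hv0 : v ≠ 0) (hw0 : w ≠ 0) (hD0 : v * w ≠ u ^ (k + 3))
    (hv : v ^ (k + 2) = c * u ^ (k + 2) - e * w)
    (hw : w ^ (k + 2) = cs * u ^ (k + 2) - es * v)
    (hu : u ^ ((k + 2) ^ 2) = c * cs * u ^ (k + 2) - c * es * v - cs * e * w + e * es * u)
    (hD : e * es = (v * w - u ^ (k + 3)) ^ (k + 1)) :
    u ^ ((k + 3) * (k + 1)) =
      e * es - ∑ i ∈ Finset.range (k + 1), (v * w) ^ (i + 1) * (u ^ (k + 3)) ^ (k - i) ∧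
    u ^ (k * (k + 3) + 1) * v = e * cs - c * w ^ (k + 1) -
      ∑ i ∈ Finset.range k, u * v * ((v * w) ^ (i + 1) * (u ^ (k + 3)) ^ (k - (i + 1))) ∧
    u ^ (k * (k + 3) + 1) * w = es * c - cs * v ^ (k + 1) -
      ∑ i ∈ Finset.range k, u * w * ((v * w) ^ (i + 1) * (u ^ (k + 3)) ^ (k - (i + 1))) := by
  have h1 : u ^ ((k + 3) * (k + 1)) =
      e * es - ∑ i ∈ Finset.range (k + 1), (v * w) ^ (i + 1) * (u ^ (k + 3)) ^ (k - i) := by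
    have := sub_pow_fintypeCard_sub_one (F := F) hF hD0
    rw [show k + 2 - 1 = k + 1 from rfl] at this
    rw [hD, this, Finset.sum_range_succ', pow_mul]
    simp
  have h2 : ∑ i ∈ Finset.range (k + 1), (v * w) ^ (i + 1) * (u ^ (k + 3)) ^ (k - i) =
      v * w * (u ^ (k * (k + 3)) +
        ∑ i ∈ Finset.range k, (v * w) ^ (i + 1) * (u ^ (k + 3)) ^ (k - (i + 1))) := by
    rw [Finset.sum_range_succ', mul_add, Finset.mul_sum, Nat.sub_zero, ← pow_mul, add_comm]
    congr 1
    · ring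
    · exact Finset.sum_congr rfl fun i _ => by ring
  rw [h2] at h1 ⊢
  have h3 : u ^ ((k + 2) ^ 2) = u ^ ((k + 3) * (k + 1)) * u := by ring
  rw [h3, h1] at hu
  rw [← Finset.mul_sum, ← Finset.mul_sum]
  refine ⟨h1, mul_right_cancel₀ hw0 ?_, mul_right_cancel₀ hv0 ?_⟩
  · linear_combination -hu + c * hw
  · linear_combination -hu + cs * hv

end Relations

section Dickson

variable {F : Type} [Field F]

/-- The substitution of `M • (x₁, x₂)` for `(x₁, x₂)`, fixing `y₁` and `y₂`. -/
def substX (M : Matrix (Fin 2) (Fin 2) F) : R2 F →ₐ[F] R2 F :=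
  aeval ![C (M 0 0) * X 0 + C (M 0 1) * X 1, C (M 1 0) * X 0 + C (M 1 1) * X 1, X 2, X 3]

/-- The involution `x₁ ↔ y₂`, `x₂ ↔ y₁`. -/
def revHom (F : Type) [Field F] : R2 F →ₐ[F] R2 F := rename Fin.rev

/-- The polynomials invariant under all substitutions in `x₁, x₂` alone. -/
def xInvariants (F : Type) [Field F] : Subalgebra F (R2 F) where
  carrier := {f | ∀ M : GL (Fin 2) F, substX M.val f = f}
  mul_mem' := fun hf hg M => by rw [map_mul, hf M, hg M]
  add_mem' := fun hf hg M => by rw [map_add, hf M, hg M]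
  algebraMap_mem' := fun r M => (substX M.val).commutes r

/-- The polynomials invariant under all substitutions in `y₁, y₂` alone. -/
def yInvariants (F : Type) [Field F] : Subalgebra F (R2 F) := (xInvariants F).comap (revHom F)

section Substitution

variable (M : Matrix (Fin 2) (Fin 2) F)

@[simp] theorem substX_X_zero : substX M (X 0) = C (M 0 0) * X 0 + C (M 0 1) * X 1 := by
  simp [substX]

@[simp] theorem substX_X_one : substX M (X 1) = C (M 1 0) * X 0 + C (M 1 1) * X 1 := by
  simp [substX]

@[simp] theorem substX_X_two : substX M (X 2) = X 2 := by
  simp [substX]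

@[simp] theorem substX_X_three : substX M (X 3) = X 3 := by
  simp [substX]

end Substitution

@[simp] theorem revHom_X (i : Fin 4) : revHom F (X i) = X i.rev := by
  simp [revHom]

@[simp] theorem revHom_revHom (f : R2 F) : revHom F (revHom F f) = f := by
  rw [revHom, rename_rename, Fin.rev_involutive.comp_self, rename_id_apply]

theorem revHom_injective : Function.Injective (revHom F) :=
  Function.LeftInverse.injective revHom_revHom

@[simp] theorem revHom_d22 (q : ℕ) : revHom F (d22 F q) = d22s F q := by
  simp [d22, d22s, Fin.rev]

@[simp] theorem revHom_d22s (q : ℕ) : revHom F (d22s F q) = d22 F q := by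
  rw [← revHom_d22, revHom_revHom]

@[simp] theorem revHom_u0 : revHom F (u0 F) = u0 F := by
  simp [u0, Fin.rev]; ring

@[simp] theorem revHom_u1 (q : ℕ) : revHom F (u1 F q) = u1s F q := by
  simp [u1, u1s, Fin.rev]; ring

@[simp] theorem revHom_u1s (q : ℕ) : revHom F (u1s F q) = u1 F q := by
  rw [← revHom_u1, revHom_revHom]

theorem X_two_mem_xInvariants : (X 2 : R2 F) ∈ xInvariants F := fun M => substX_X_two M.val

theorem X_three_mem_xInvariants : (X 3 : R2 F) ∈ xInvariants F := fun M => substX_X_three M.val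

theorem d22s_mem_xInvariants (q : ℕ) : d22s F q ∈ xInvariants F := fun M => by
  simp [d22s]

variable [Fintype F] {q : ℕ}

theorem linearForm_pow (hF : Fintype.card F = q) (a b : F) (x y : R2 F) :
    (C a * x + C b * y) ^ q = C a * x ^ q + C b * y ^ q := by
  rw [add_pow_fintypeCard hF, mul_pow, mul_pow, ← map_pow, ← map_pow, ← hF,
    FiniteField.pow_card, FiniteField.pow_card]

theorem linearForm_pow_sq (hF : Fintype.card F = q) (a b : F) (x y : R2 F) :
    (C a * x + C b * y) ^ (q ^ 2) = C a * x ^ (q ^ 2) + C b * y ^ (q ^ 2) := by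
  rw [sq, pow_mul, linearForm_pow hF, linearForm_pow hF, ← pow_mul, ← pow_mul]

theorem substX_d22 (hF : Fintype.card F = q) (M : Matrix (Fin 2) (Fin 2) F) :
    substX M (d22 F q) = C M.det * d22 F q := by
  simp only [d22, map_sub, map_mul, map_pow, substX_X_zero, substX_X_one, linearForm_pow hF,
    Matrix.det_fin_two]
  ring

theorem two_le_of_card (hF : Fintype.card F = q) : 2 ≤ q := hF ▸ Fintype.one_lt_card

theorem d22_ne_zero (hF : Fintype.card F = q) : d22 F q ≠ 0 := by
  intro h
  have := congrArg (aeval ![(Polynomial.X : Polynomial F), 1, 0, 0]) h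
  simp only [d22, map_sub, map_mul, map_pow, aeval_X, map_zero] at this
  simp at this
  exact FiniteField.X_pow_card_sub_X_ne_zero F (two_le_of_card hF) this

theorem d22s_ne_zero (hF : Fintype.card F = q) : d22s F q ≠ 0 := by
  rw [← revHom_d22, map_ne_zero_iff _ revHom_injective]
  exact d22_ne_zero hF

theorem det_pow_card_sub_one (hF : Fintype.card F = q) (M : GL (Fin 2) F) :
    M.val.det ^ (q - 1) = 1 :=
  hF ▸ FiniteField.pow_card_sub_one_eq_one _ ((Matrix.isUnit_iff_isUnit_det _).1 M.isUnit).ne_zero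

theorem d22_pow_mem_xInvariants (hF : Fintype.card F = q) :
    d22 F q ^ (q - 1) ∈ xInvariants F := fun M => by
  rw [map_pow, substX_d22 hF, mul_pow, ← map_pow, det_pow_card_sub_one hF, map_one, one_mul]

variable {c21 c21s : R2 F}

theorem revHom_c21 (hF : Fintype.card F = q)
    (hc : d22 F q * c21 = X 1 * X 0 ^ (q ^ 2) - X 0 * X 1 ^ (q ^ 2))
    (hcs : d22s F q * c21s = X 2 * X 3 ^ (q ^ 2) - X 3 * X 2 ^ (q ^ 2)) :
    revHom F c21 = c21s := by
  apply mul_left_cancel₀ (d22s_ne_zero hF)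
  rw [hcs, ← revHom_d22, ← map_mul, hc]
  simp [Fin.rev]

theorem c21_mem_xInvariants (hF : Fintype.card F = q)
    (hc : d22 F q * c21 = X 1 * X 0 ^ (q ^ 2) - X 0 * X 1 ^ (q ^ 2)) :
    c21 ∈ xInvariants F := fun M => by
  have hM : (C M.val.det : R2 F) ≠ 0 := by
    rw [Ne, C_eq_zero]
    exact ((Matrix.isUnit_iff_isUnit_det _).1 M.isUnit).ne_zero
  apply mul_left_cancel₀ (mul_ne_zero hM (d22_ne_zero hF))
  rw [← substX_d22 hF, ← map_mul, hc, substX_d22 hF, mul_assoc, hc]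
  simp only [map_sub, map_mul, map_pow, substX_X_zero, substX_X_one, linearForm_pow_sq hF,
    Matrix.det_fin_two]
  ring

theorem c21s_mem_xInvariants (hF : Fintype.card F = q)
    (hcs : d22s F q * c21s = X 2 * X 3 ^ (q ^ 2) - X 3 * X 2 ^ (q ^ 2)) :
    c21s ∈ xInvariants F := fun M => by
  apply mul_left_cancel₀ (d22s_ne_zero hF)
  nth_rewrite 1 [← d22s_mem_xInvariants q M]
  rw [← map_mul, hcs]
  simp

theorem mem_span_dicksonMonomial (hF : Fintype.card F = q)
    (hc : d22 F q * c21 = X 1 * X 0 ^ (q ^ 2) - X 0 * X 1 ^ (q ^ 2))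
    {A : Subalgebra F (R2 F)} (heA : d22 F q ^ (q - 1) ∈ A) (hcA : c21 ∈ A) {T : Set (R2 F)}
    (hT : ∀ t ∈ T, t ∈ A ∨ t = X 0 ∨ t = X 1) {f : R2 F} (hf : f ∈ Algebra.adjoin F T) :
    f ∈ Submodule.span A (Set.range (dicksonMonomial q (X 0 : R2 F) (X 1))) := by
  have hq := two_le_of_card hF
  have hsum := dickson_eq_sum hq rfl (d22_ne_zero hF) hc
  have hx : (X 0 : R2 F) ^ (q ^ 2 - 1) = c21 * X 0 ^ (q - 1) - d22 F q ^ (q - 1) := by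
    apply mul_right_cancel₀ (X_ne_zero (R := F) (0 : Fin 4))
    have h := (dickson_equation hF rfl (d22_ne_zero hF) hc).1
    rw [sub_mul, mul_assoc, ← pow_succ, ← pow_succ, Nat.sub_add_cancel (by nlinarith),
      Nat.sub_add_cancel (by omega)]
    exact h
  have key := pow_mul_pow_mem_span_dicksonMonomial hq heA hcA hx hsum
  refine mem_of_mem_adjoin (by simpa using key 0 0) (fun t ht n hn => ?_) hf
  rcases hT t ht with h | rfl | rfl
  · exact mul_mem_span_of_mem h hn
  · refine mul_mem_span_range (fun i => ?_) hn
    rw [dicksonMonomial, ← mul_assoc, ← pow_succ']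
    exact key _ _
  · refine mul_mem_span_range (fun i => ?_) hn
    rw [dicksonMonomial, mul_left_comm, ← pow_succ']
    exact key _ _

theorem card_GL_two (hF : Fintype.card F = q) :
    Nat.card (GL (Fin 2) F) = (q ^ 2 - 1) * (q ^ 2 - q) := by
  rw [Matrix.card_GL_field, hF, Fin.prod_univ_two]
  simp

theorem substX_injective (hF : Fintype.card F = q) :
    Function.Injective fun M : GL (Fin 2) F => substX M.val (X 0 + X 1 ^ q) := by
  have hq := two_le_of_card hF
  intro M N h
  simp only [map_add, map_pow, substX_X_zero, substX_X_one, linearForm_pow hF] at h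
  have key : ∀ s, _ := fun s => congrArg (coeff s) h
  simp only [coeff_add, coeff_C_mul, coeff_X_pow, coeff_X] at key
  have h0 := key (Finsupp.single 0 1)
  have h1 := key (Finsupp.single 1 1)
  have h2 := key (Finsupp.single 0 q)
  have h3 := key (Finsupp.single 1 q)
  simp [Finsupp.single_eq_single_iff, show q ≠ 1 by omega, show (1 : ℕ) ≠ q by omega,
    show q ≠ 0 by omega] at h0 h1 h2 h3
  ext i j
  fin_cases i <;> fin_cases j
  exacts [h0, h1, h2, h3]

/-- A polynomial invariant in `x₁, x₂` which is spanned by monomials in `x₁, x₂` over an algebra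
of such invariants lies in that algebra. -/
theorem mem_of_mem_span_dicksonMonomial (hF : Fintype.card F = q)
    (hc : d22 F q * c21 = X 1 * X 0 ^ (q ^ 2) - X 0 * X 1 ^ (q ^ 2))
    {A : Subalgebra F (R2 F)} (hA : A ≤ xInvariants F) {f : R2 F} (hfx : f ∈ xInvariants F)
    (hf : f ∈ Submodule.span A (Set.range (dicksonMonomial q (X 0 : R2 F) (X 1)))) : f ∈ A := by
  classical
  have hq := two_le_of_card hF
  obtain ⟨a, ha⟩ := (Submodule.mem_span_range_iff_exists_fun A).1 hf
  have hqq : q < q ^ 2 := by nlinarith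
  let i₀ : Fin (q ^ 2 - 1) × Fin (q ^ 2 - q) := (⟨0, by omega⟩, ⟨0, by omega⟩)
  have hm : dicksonMonomial q (X 0 : R2 F) (X 1) i₀ = 1 := by simp [dicksonMonomial, i₀]
  let _ : Fintype (GL (Fin 2) F) := Fintype.ofFinite _
  have h := eq_zero_of_sum_mul_eq_zero_of_conjugates (xInvariants F)
    (fun M : GL (Fin 2) F => substX M.val) (fun M c hcx => hcx M) (X 0 + X 1 ^ q)
    (substX_injective hF)
    (by rw [← Nat.card_eq_fintype_card (α := GL (Fin 2) F), card_GL_two hF]; simp)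
    (dicksonMonomial q (X 0 : R2 F) (X 1))
    (fun k => mem_span_dicksonMonomial hF hc (d22_pow_mem_xInvariants hF)
      (c21_mem_xInvariants hF hc) (T := Set.range X) (by
        rintro _ ⟨i, rfl⟩
        fin_cases i
        · exact Or.inr (Or.inl rfl)
        · exact Or.inr (Or.inr rfl)
        · exact Or.inl X_two_mem_xInvariants
        · exact Or.inl X_three_mem_xInvariants) (by rw [adjoin_range_X]; trivial))
    (fun i => a i - if i = i₀ then f else 0)
    (fun i => sub_mem (hA (a i).2) (by split_ifs; exacts [hfx, zero_mem _]))
    (by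
      simp only [sub_mul, Finset.sum_sub_distrib, ite_mul, zero_mul]
      rw [Finset.sum_ite_eq' Finset.univ i₀, if_pos (Finset.mem_univ _), hm, mul_one, sub_eq_zero]
      exact ha)
    i₀
  rw [if_pos rfl, sub_eq_zero] at h
  exact h ▸ (a i₀).2

/-- Dickson's theorem for `GL₂`, with `y₁, y₂` as additional coefficients. -/
theorem xInvariants_le (hF : Fintype.card F = q)
    (hc : d22 F q * c21 = X 1 * X 0 ^ (q ^ 2) - X 0 * X 1 ^ (q ^ 2)) :
    xInvariants F ≤ Algebra.adjoin F {d22 F q ^ (q - 1), c21, X 2, X 3} := by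
  intro f hf
  refine mem_of_mem_span_dicksonMonomial hF hc (Algebra.adjoin_le ?_) hf
    (mem_span_dicksonMonomial hF hc (Algebra.subset_adjoin (by simp))
      (Algebra.subset_adjoin (by simp)) (T := Set.range X) ?_ (by rw [adjoin_range_X]; trivial))
  · rintro _ (rfl | rfl | rfl | rfl)
    exacts [d22_pow_mem_xInvariants hF, c21_mem_xInvariants hF hc, X_two_mem_xInvariants,
      X_three_mem_xInvariants]
  · rintro _ ⟨i, rfl⟩
    fin_cases i
    · exact Or.inr (Or.inl rfl)
    · exact Or.inr (Or.inr rfl)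
    · exact Or.inl (Algebra.subset_adjoin (by simp))
    · exact Or.inl (Algebra.subset_adjoin (by simp))

/-- The algebra generated by the Dickson invariants of both pairs of variables. -/
def dicksonAlgebra (q : ℕ) (c21 c21s : R2 F) : Subalgebra F (R2 F) :=
  Algebra.adjoin F {d22 F q ^ (q - 1), c21, d22s F q ^ (q - 1), c21s}

theorem dicksonAlgebra_le_xInvariants (hF : Fintype.card F = q)
    (hc : d22 F q * c21 = X 1 * X 0 ^ (q ^ 2) - X 0 * X 1 ^ (q ^ 2))
    (hcs : d22s F q * c21s = X 2 * X 3 ^ (q ^ 2) - X 3 * X 2 ^ (q ^ 2)) :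
    dicksonAlgebra q c21 c21s ≤ xInvariants F := by
  refine Algebra.adjoin_le ?_
  rintro _ (rfl | rfl | rfl | rfl)
  exacts [d22_pow_mem_xInvariants hF, c21_mem_xInvariants hF hc,
    pow_mem (d22s_mem_xInvariants q) _, c21s_mem_xInvariants hF hcs]

theorem dicksonAlgebra_le_yInvariants (hF : Fintype.card F = q)
    (hc : d22 F q * c21 = X 1 * X 0 ^ (q ^ 2) - X 0 * X 1 ^ (q ^ 2))
    (hcs : d22s F q * c21s = X 2 * X 3 ^ (q ^ 2) - X 3 * X 2 ^ (q ^ 2)) :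
    dicksonAlgebra q c21 c21s ≤ yInvariants F := by
  have h := revHom_c21 hF hc hcs
  refine Algebra.adjoin_le ?_
  rintro _ (rfl | rfl | rfl | rfl)
  · change revHom F _ ∈ xInvariants F
    rw [map_pow, revHom_d22]
    exact pow_mem (d22s_mem_xInvariants q) _
  · change revHom F _ ∈ xInvariants F
    rw [h]
    exact c21s_mem_xInvariants hF hcs
  · change revHom F _ ∈ xInvariants F
    rw [map_pow, revHom_d22s]
    exact d22_pow_mem_xInvariants hF
  · change revHom F _ ∈ xInvariants F
    rw [← h, revHom_revHom]
    exact c21_mem_xInvariants hF hc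

theorem mem_dicksonAlgebra (hF : Fintype.card F = q)
    (hc : d22 F q * c21 = X 1 * X 0 ^ (q ^ 2) - X 0 * X 1 ^ (q ^ 2))
    (hcs : d22s F q * c21s = X 2 * X 3 ^ (q ^ 2) - X 3 * X 2 ^ (q ^ 2))
    {f : R2 F} (hx : f ∈ xInvariants F) (hy : f ∈ yInvariants F) :
    f ∈ dicksonAlgebra q c21 c21s := by
  have h := revHom_c21 hF hc hcs
  have h1 : revHom F f ∈ Algebra.adjoin F {d22 F q ^ (q - 1), c21, X 2, X 3} :=
    xInvariants_le hF hc hy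
  have h2 : f ∈ Algebra.adjoin F (revHom F '' {d22 F q ^ (q - 1), c21, X 2, X 3}) := by
    rw [← AlgHom.map_adjoin]
    exact ⟨_, h1, revHom_revHom f⟩
  refine mem_of_mem_span_dicksonMonomial hF hc (dicksonAlgebra_le_xInvariants hF hc hcs) hx
    (mem_span_dicksonMonomial hF hc (Algebra.subset_adjoin (by simp))
      (Algebra.subset_adjoin (by simp)) ?_ h2)
  rintro _ ⟨_, rfl | rfl | rfl | rfl, rfl⟩
  · exact Or.inl (Algebra.subset_adjoin (by simp))
  · exact Or.inl (Algebra.subset_adjoin (by simp [h]))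
  · exact Or.inr (Or.inr (by simp [Fin.rev]))
  · exact Or.inr (Or.inl (by simp [Fin.rev]))

end Dickson

section Pairing

variable {F : Type} [Field F]

section Action

variable (A : GL (Fin 2) F)

@[simp] theorem act_X_zero : act A (X 0) =
    C ((A.val.det)⁻¹ * A.val 1 1) * X 0 - C ((A.val.det)⁻¹ * A.val 1 0) * X 1 := by
  simp [act]

@[simp] theorem act_X_one : act A (X 1) =
    C ((A.val.det)⁻¹ * A.val 0 0) * X 1 - C ((A.val.det)⁻¹ * A.val 0 1) * X 0 := by
  simp [act]

@[simp] theorem act_X_two : act A (X 2) = C (A.val 0 0) * X 2 + C (A.val 0 1) * X 3 := by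
  simp [act]

@[simp] theorem act_X_three : act A (X 3) = C (A.val 1 0) * X 2 + C (A.val 1 1) * X 3 := by
  simp [act]

theorem det_val_ne_zero : A.val.det ≠ 0 :=
  ((Matrix.isUnit_iff_isUnit_det _).1 A.isUnit).ne_zero

end Action

/-- The substitution of `u₀, u₁` for `y₁, y₂`, fixing `x₁` and `x₂`. -/
def pairHom (F : Type) [Field F] (q : ℕ) : R2 F →ₐ[F] R2 F :=
  aeval ![X 0, X 1, u0 F, u1 F q]

section PairHom

variable (q : ℕ)

@[simp] theorem pairHom_X_zero : pairHom F q (X 0) = X 0 := by simp [pairHom]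

@[simp] theorem pairHom_X_one : pairHom F q (X 1) = X 1 := by simp [pairHom]

@[simp] theorem pairHom_X_two : pairHom F q (X 2) = u0 F := by simp [pairHom]

@[simp] theorem pairHom_X_three : pairHom F q (X 3) = u1 F q := by simp [pairHom]

@[simp] theorem pairHom_d22 : pairHom F q (d22 F q) = d22 F q := by simp [d22]

end PairHom

/-- The action of `A` as a substitution in `x₁, x₂` composed with one in `y₁, y₂`. -/
theorem act_eq_substX_revHom (A : GL (Fin 2) F) (f : R2 F) :
    act A f = substX ((A.val.det)⁻¹ • !![A.val 1 1, -A.val 1 0; -A.val 0 1, A.val 0 0])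
      (revHom F (substX !![A.val 1 1, A.val 1 0; A.val 0 1, A.val 0 0] (revHom F f))) := by
  simp only [← AlgHom.comp_apply]
  refine DFunLike.congr_fun (algHom_ext fun i => ?_) f
  fin_cases i
  · simp [Fin.rev]; ring
  · simp [Fin.rev]; ring
  · simp [Fin.rev]; ring
  · simp [Fin.rev]; ring

theorem xInvariants_inf_yInvariants_le :
    xInvariants F ⊓ yInvariants F ≤ invariantRing (⊤ : Subgroup (GL (Fin 2) F)) := by
  rintro f ⟨hx, hy⟩ A -
  have hA := det_val_ne_zero A
  have hA' := hA
  rw [Matrix.det_fin_two] at hA'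
  rw [act_eq_substX_revHom]
  have h1 : substX !![A.val 1 1, A.val 1 0; A.val 0 1, A.val 0 0] (revHom F f) = revHom F f :=
    hy (Matrix.GeneralLinearGroup.mkOfDetNeZero _
      (by rw [Matrix.det_fin_two_of]; convert hA' using 1; ring))
  rw [h1, revHom_revHom]
  exact hx (Matrix.GeneralLinearGroup.mkOfDetNeZero _
    (by
      rw [Matrix.det_smul, Matrix.det_fin_two_of]
      refine mul_ne_zero (pow_ne_zero _ (inv_ne_zero hA)) ?_
      convert hA' using 1; ring))

theorem u0_mem_invariantRing : u0 F ∈ invariantRing (⊤ : Subgroup (GL (Fin 2) F)) := by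
  rintro A -
  have hA := det_val_ne_zero A
  have h : (C (A.val.det)⁻¹ * C A.val.det : R2 F) = 1 := by rw [← C_mul, inv_mul_cancel₀ hA, C_1]
  rw [Matrix.det_fin_two, C_sub, C_mul, C_mul, ← Matrix.det_fin_two] at h
  simp only [u0, map_add, map_mul, act_X_zero, act_X_one, act_X_two, act_X_three]
  linear_combination (X 0 * X 2 + X 1 * X 3) * h

/-- The involution `x₁ ↔ y₂`, `x₂ ↔ y₁` normalizes the action of `GL₂`. -/
theorem exists_act_revHom (A : GL (Fin 2) F) :
    ∃ B : GL (Fin 2) F, ∀ f, act A (revHom F f) = revHom F (act B f) := by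
  have hA := det_val_ne_zero A
  have hA' := hA
  rw [Matrix.det_fin_two] at hA'
  let B : Matrix (Fin 2) (Fin 2) F :=
    !![(A.val.det)⁻¹ * A.val 0 0, -((A.val.det)⁻¹ * A.val 0 1);
      -((A.val.det)⁻¹ * A.val 1 0), (A.val.det)⁻¹ * A.val 1 1]
  have hB : B.det = (A.val.det)⁻¹ := by
    simp only [B, Matrix.det_fin_two_of]
    simp only [Matrix.det_fin_two]
    field_simp
  refine ⟨Matrix.GeneralLinearGroup.mkOfDetNeZero B (hB ▸ inv_ne_zero hA), fun f => ?_⟩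
  change ((act A).comp (revHom F)) f = ((revHom F).comp (act _)) f
  congr 1
  apply algHom_ext
  intro i
  fin_cases i <;>
    simp [Fin.rev, hB, B, hA] <;> ring

theorem revHom_mem_invariantRing {f : R2 F}
    (hf : f ∈ invariantRing (⊤ : Subgroup (GL (Fin 2) F))) :
    revHom F f ∈ invariantRing (⊤ : Subgroup (GL (Fin 2) F)) := by
  rintro A -
  obtain ⟨B, hB⟩ := exists_act_revHom A
  rw [hB, hf B trivial]

theorem exists_d22_pow_mul_mem_range (q : ℕ) (f : R2 F) :
    ∃ n, d22 F q ^ n * f ∈ (pairHom F q).range := by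
  have hd : d22 F q ∈ (pairHom F q).range := ⟨_, pairHom_d22 q⟩
  have hX : ∀ i, d22 F q * X i ∈ (pairHom F q).range := by
    intro i
    fin_cases i
    · exact mul_mem hd ⟨_, pairHom_X_zero q⟩
    · exact mul_mem hd ⟨_, pairHom_X_one q⟩
    · exact ⟨X 1 * X 3 - X 1 ^ q * X 2, by simp [d22, u0, u1]; ring⟩
    · exact ⟨X 0 ^ q * X 2 - X 0 * X 3, by simp [d22, u0, u1]; ring⟩
  induction f using MvPolynomial.induction_on with
  | C a => exact ⟨0, by simpa using (pairHom F q).range.algebraMap_mem a⟩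
  | add f g hf hg =>
    obtain ⟨m, hm⟩ := hf
    obtain ⟨n, hn⟩ := hg
    refine ⟨m + n, ?_⟩
    have : d22 F q ^ (m + n) * (f + g) =
        d22 F q ^ n * (d22 F q ^ m * f) + d22 F q ^ m * (d22 F q ^ n * g) := by ring
    rw [this]
    exact add_mem (mul_mem (pow_mem hd n) hm) (mul_mem (pow_mem hd m) hn)
  | mul_X f i hf =>
    obtain ⟨n, hn⟩ := hf
    refine ⟨n + 1, ?_⟩
    have : d22 F q ^ (n + 1) * (f * X i) = d22 F q ^ n * f * (d22 F q * X i) := by ring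
    rw [this]
    exact mul_mem hn (hX i)

variable [Fintype F] {q : ℕ}

theorem pairHom_injective (hF : Fintype.card F = q) : Function.Injective (pairHom F q) := by
  obtain ⟨i, hi⟩ : ∃ i : R2 F →ₐ[F] FractionRing (R2 F), Function.Injective i :=
    ⟨IsScalarTower.toAlgHom F (R2 F) _, IsFractionRing.injective (R2 F) _⟩
  have hd : i (d22 F q) ≠ 0 := (map_ne_zero_iff _ hi).2 (d22_ne_zero hF)
  let g : R2 F →ₐ[F] FractionRing (R2 F) := aeval ![i (X 0), i (X 1),
    i (X 1 * X 3 - X 1 ^ q * X 2) / i (d22 F q), i (X 0 ^ q * X 2 - X 0 * X 3) / i (d22 F q)]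
  have hg : g.comp (pairHom F q) = i := by
    apply algHom_ext
    intro j
    fin_cases j
    · simp [g]
    · simp [g]
    · simp [g, u0]
      field_simp
      simp [d22]
      ring
    · simp [g, u1]
      field_simp
      simp [d22]
      ring
  rw [← hg, AlgHom.coe_comp] at hi
  exact hi.of_comp

theorem u1_mem_invariantRing (hF : Fintype.card F = q) :
    u1 F q ∈ invariantRing (⊤ : Subgroup (GL (Fin 2) F)) := by
  rintro A -
  have hA := det_val_ne_zero A
  have h : (C (A.val.det)⁻¹ * C A.val.det : R2 F) = 1 := by rw [← C_mul, inv_mul_cancel₀ hA, C_1]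
  have hC : ∀ a : F, (C a : R2 F) ^ q = C a := fun a => by
    rw [← C_pow, ← hF, FiniteField.pow_card]
  rw [Matrix.det_fin_two, C_sub, C_mul, C_mul, ← Matrix.det_fin_two] at h
  simp only [u1, map_add, map_mul, map_pow, act_X_zero, act_X_one, act_X_two, act_X_three,
    sub_pow_fintypeCard hF, mul_pow, hC]
  linear_combination (X 0 ^ q * X 2 + X 1 ^ q * X 3) * h

/-- Every substitution in `x₁, x₂` is intertwined by `pairHom` with the action of some matrix. -/
theorem exists_act_pairHom (hF : Fintype.card F = q) (M : GL (Fin 2) F) :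
    ∃ A : GL (Fin 2) F, ∀ f, act A (pairHom F q f) = pairHom F q (substX M.val f) := by
  have hM := det_val_ne_zero M
  have hM' := hM
  rw [Matrix.det_fin_two] at hM'
  let B : Matrix (Fin 2) (Fin 2) F :=
    !![(M.val.det)⁻¹ * M.val 1 1, -((M.val.det)⁻¹ * M.val 1 0);
      -((M.val.det)⁻¹ * M.val 0 1), (M.val.det)⁻¹ * M.val 0 0]
  have hB : B.det = (M.val.det)⁻¹ := by
    simp only [B, Matrix.det_fin_two_of]
    simp only [Matrix.det_fin_two]
    field_simp
  let A := Matrix.GeneralLinearGroup.mkOfDetNeZero B (hB ▸ inv_ne_zero hM)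
  have hval : A.val = B := rfl
  refine ⟨A, fun f => ?_⟩
  change ((act A).comp (pairHom F q)) f = ((pairHom F q).comp (substX M.val)) f
  congr 1
  apply algHom_ext
  intro i
  fin_cases i
  · simp [hval, hB, B, hM]
  · simp [hval, hB, B, hM]; ring
  · simpa using u0_mem_invariantRing A trivial
  · simpa using u1_mem_invariantRing hF A trivial

variable {c21 c21s : R2 F}

theorem adjoin_le_invariantRing (hF : Fintype.card F = q)
    (hc : d22 F q * c21 = X 1 * X 0 ^ (q ^ 2) - X 0 * X 1 ^ (q ^ 2))
    (hcs : d22s F q * c21s = X 2 * X 3 ^ (q ^ 2) - X 3 * X 2 ^ (q ^ 2)) :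
    Algebra.adjoin F
        {d22 F q ^ (q - 1), c21, d22s F q ^ (q - 1), c21s, u1s F q, u0 F, u1 F q} ≤
      invariantRing (⊤ : Subgroup (GL (Fin 2) F)) := by
  have h : dicksonAlgebra q c21 c21s ≤ invariantRing (⊤ : Subgroup (GL (Fin 2) F)) :=
    (le_inf (dicksonAlgebra_le_xInvariants hF hc hcs)
      (dicksonAlgebra_le_yInvariants hF hc hcs)).trans xInvariants_inf_yInvariants_le
  refine Algebra.adjoin_le ?_
  rintro _ (rfl | rfl | rfl | rfl | rfl | rfl | rfl)
  · exact h (Algebra.subset_adjoin (by simp))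
  · exact h (Algebra.subset_adjoin (by simp))
  · exact h (Algebra.subset_adjoin (by simp))
  · exact h (Algebra.subset_adjoin (by simp))
  · rw [← revHom_u1]
    exact revHom_mem_invariantRing (u1_mem_invariantRing hF)
  · exact u0_mem_invariantRing
  · exact u1_mem_invariantRing hF

theorem exists_pow_mul_mem_adjoin (hF : Fintype.card F = q)
    (hc : d22 F q * c21 = X 1 * X 0 ^ (q ^ 2) - X 0 * X 1 ^ (q ^ 2))
    {f : R2 F} (hf : f ∈ invariantRing (⊤ : Subgroup (GL (Fin 2) F))) :
    ∃ n, (d22 F q ^ (q - 1)) ^ n * f ∈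
      Algebra.adjoin F {d22 F q ^ (q - 1), c21, u0 F, u1 F q} := by
  obtain ⟨n, P₀, hP₀⟩ := exists_d22_pow_mul_mem_range q f
  have hq := two_le_of_card hF
  obtain ⟨m, hm⟩ := Nat.exists_eq_add_of_le (Nat.le_mul_of_pos_left n (show 0 < q - 1 by omega))
  obtain ⟨P, hP⟩ : ∃ P, pairHom F q P = (d22 F q ^ (q - 1)) ^ n * f := by
    refine ⟨d22 F q ^ m * P₀, ?_⟩
    rw [← pow_mul, hm, pow_add, mul_comm (_ ^ n), mul_assoc, ← hP₀]
    simp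
  have hPx : P ∈ xInvariants F := by
    intro M
    obtain ⟨A, hA⟩ := exists_act_pairHom hF M
    apply pairHom_injective hF
    have he : act A (d22 F q ^ (q - 1)) = d22 F q ^ (q - 1) := by
      have := hA (d22 F q ^ (q - 1))
      rwa [d22_pow_mem_xInvariants hF M, map_pow, pairHom_d22] at this
    rw [← hA, hP, map_mul, map_pow, he, hf A trivial]
  have hPc : pairHom F q c21 = c21 := by
    apply mul_left_cancel₀ (d22_ne_zero hF)
    nth_rewrite 1 [← pairHom_d22]
    rw [← map_mul, hc]
    simp
  refine ⟨n, hP ▸ ?_⟩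
  have h : pairHom F q P ∈ (Algebra.adjoin F {d22 F q ^ (q - 1), c21, X 2, X 3}).map
      (pairHom F q) := ⟨P, xInvariants_le hF hc hPx, rfl⟩
  rw [AlgHom.map_adjoin] at h
  refine Algebra.adjoin_mono ?_ h
  rintro _ ⟨_, rfl | rfl | rfl | rfl, rfl⟩ <;> simp [hPc]

end Pairing

section Generation

variable {F : Type} [Field F]

theorem substX_u0_injective :
    Function.Injective fun M : GL (Fin 2) F => substX M.val (u0 F) := by
  intro M N h
  simp only [u0, map_add, map_mul, substX_X_zero, substX_X_one, substX_X_two,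
    substX_X_three] at h
  have h00 := congrArg (eval ![1, 0, 1, 0]) h
  have h01 := congrArg (eval ![0, 1, 1, 0]) h
  have h10 := congrArg (eval ![1, 0, 0, 1]) h
  have h11 := congrArg (eval ![0, 1, 0, 1]) h
  simp at h00 h01 h10 h11
  ext i j
  fin_cases i <;> fin_cases j
  exacts [h00, h01, h10, h11]

theorem eq_C_of_degreeOf_eq_zero {σ : Type*} {p : MvPolynomial σ F}
    (h : ∀ i, degreeOf i p = 0) : ∃ a, p = C a := by
  classical
  refine ⟨_, vars_eq_empty_iff_eq_C.1 (Finset.eq_empty_of_forall_notMem fun i hi => ?_)⟩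
  rw [mem_vars_iff_degreeOf_ne_zero] at hi
  exact hi (h i)

theorem degreeOf_d22 (q : ℕ) (i : Fin 4) (h0 : i ≠ 0) (h1 : i ≠ 1) :
    degreeOf i (d22 F q) = 0 := by
  have h : ∀ j l : Fin 4, i ≠ j → i ≠ l → degreeOf i (X j * X l ^ q : R2 F) ≤ 0 := by
    intro j l hj hl
    refine (degreeOf_mul_le _ _ _).trans ?_
    rw [degreeOf_X_of_ne hj, zero_add]
    refine (degreeOf_pow_le _ _ _).trans ?_
    rw [degreeOf_X_of_ne hl, mul_zero]
  exact Nat.le_zero.1 ((degreeOf_sub_le _ _ _).trans (max_le (h _ _ h1 h0) (h _ _ h0 h1)))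

theorem degreeOf_d22s (q : ℕ) (i : Fin 4) (h2 : i ≠ 2) (h3 : i ≠ 3) :
    degreeOf i (d22s F q) = 0 := by
  have : degreeOf i (d22s F q) = degreeOf i.rev (d22 F q) := by
    have h := degreeOf_rename_of_injective (p := d22 F q) Fin.rev_injective i.rev
    rwa [Fin.rev_rev, ← revHom, revHom_d22] at h
  rw [this]
  refine degreeOf_d22 q _ ?_ ?_
  · rintro h; exact h3 (by rw [← Fin.rev_rev i, h]; rfl)
  · rintro h; exact h2 (by rw [← Fin.rev_rev i, h]; rfl)

variable [Fintype F] {q : ℕ} {c21 c21s : R2 F}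

theorem u1_ne_zero (hF : Fintype.card F = q) : u1 F q ≠ 0 := by
  have hq : q ≠ 0 := by have := two_le_of_card hF; omega
  intro h
  have := congrArg (eval ![1, 0, 1, 0]) h
  simp [u1, hq] at this

theorem u1s_ne_zero (hF : Fintype.card F = q) : u1s F q ≠ 0 := by
  rw [← revHom_u1, map_ne_zero_iff _ revHom_injective]
  exact u1_ne_zero hF

theorem mem_span_pairingMonomial {k : ℕ} (hF : Fintype.card F = k + 2)
    (hc : d22 F (k + 2) * c21 = X 1 * X 0 ^ ((k + 2) ^ 2) - X 0 * X 1 ^ ((k + 2) ^ 2))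
    (hcs : d22s F (k + 2) * c21s = X 2 * X 3 ^ ((k + 2) ^ 2) - X 3 * X 2 ^ ((k + 2) ^ 2))
    {f : R2 F} (hf : f ∈ Algebra.adjoin F {d22 F (k + 2) ^ (k + 1), c21, d22s F (k + 2) ^ (k + 1),
      c21s, u1s F (k + 2), u0 F, u1 F (k + 2)}) :
    f ∈ Submodule.span (dicksonAlgebra (k + 2) c21 c21s)
      (Set.range (pairingMonomial k (u0 F) (u1 F (k + 2)) (u1s F (k + 2)))) := by
  have hsub : ∀ t ∈ ({d22 F (k + 2) ^ (k + 1), c21, d22s F (k + 2) ^ (k + 1), c21s} : Set (R2 F)),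
      t ∈ dicksonAlgebra (k + 2) c21 c21s := fun t ht => Algebra.subset_adjoin ht
  obtain ⟨hv, hw, hu, hD⟩ := pairing_relations (d := d22 F (k + 2)) (ds := d22s F (k + 2))
    (u := u0 F) (v := u1 F (k + 2)) (w := u1s F (k + 2)) hF rfl (d22_ne_zero hF) hc rfl
    (d22s_ne_zero hF) hcs rfl rfl rfl
  have hD0 : u1 F (k + 2) * u1s F (k + 2) ≠ u0 F ^ (k + 3) := by
    rw [← sub_ne_zero]
    exact hD ▸ mul_ne_zero (d22_ne_zero hF) (d22s_ne_zero hF)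
  obtain ⟨hu', huv, huw⟩ := pairing_relations' hF (u1_ne_zero hF) (u1s_ne_zero hF) hD0 hv hw hu
    (by rw [← mul_pow, hD]; rfl)
  have key := pow_mul_pow_mul_pow_mem_span_pairingMonomial (hsub _ (by simp)) (hsub _ (by simp))
    (hsub _ (by simp)) (hsub _ (by simp)) hv hw hu' huv huw
  have hmon : ∀ i, ∃ a b c, pairingMonomial k (u0 F) (u1 F (k + 2)) (u1s F (k + 2)) i =
      u0 F ^ a * u1 F (k + 2) ^ b * u1s F (k + 2) ^ c := by
    rintro (i | i)
    · exact ⟨_, _, _, rfl⟩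
    · exact ⟨k * (k + 3) + 1 + i, 0, 0, by simp [pairingMonomial]⟩
  refine mem_of_mem_adjoin (by simpa using key 0 0 0) (fun t ht n hn => ?_) hf
  rcases ht with rfl | rfl | rfl | rfl | rfl | rfl | rfl
  · exact mul_mem_span_of_mem (hsub _ (by simp)) hn
  · exact mul_mem_span_of_mem (hsub _ (by simp)) hn
  · exact mul_mem_span_of_mem (hsub _ (by simp)) hn
  · exact mul_mem_span_of_mem (hsub _ (by simp)) hn
  · refine mul_mem_span_range (fun i => ?_) hn
    obtain ⟨a, b, c, h⟩ := hmon i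
    convert key a b (c + 1) using 1
    rw [h]; ring
  · refine mul_mem_span_range (fun i => ?_) hn
    obtain ⟨a, b, c, h⟩ := hmon i
    convert key (a + 1) b c using 1
    rw [h]; ring
  · refine mul_mem_span_range (fun i => ?_) hn
    obtain ⟨a, b, c, h⟩ := hmon i
    convert key a (b + 1) c using 1
    rw [h]; ring

theorem eq_zero_of_sum_mul_pairingMonomial_eq_zero {k : ℕ} (hF : Fintype.card F = k + 2)
    (hc : d22 F (k + 2) * c21 = X 1 * X 0 ^ ((k + 2) ^ 2) - X 0 * X 1 ^ ((k + 2) ^ 2))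
    (hcs : d22s F (k + 2) * c21s = X 2 * X 3 ^ ((k + 2) ^ 2) - X 3 * X 2 ^ ((k + 2) ^ 2))
    (a : (Fin (k * (k + 3) + 1) × Fin (k + 2) × Fin (k + 2)) ⊕ Fin (k + 2) → R2 F)
    (ha : ∀ i, a i ∈ dicksonAlgebra (k + 2) c21 c21s)
    (h0 : ∑ i, a i * pairingMonomial k (u0 F) (u1 F (k + 2)) (u1s F (k + 2)) i = 0) :
    ∀ i, a i = 0 := by
  let _ : Fintype (GL (Fin 2) F) := Fintype.ofFinite _
  refine eq_zero_of_sum_mul_eq_zero_of_conjugates (dicksonAlgebra (k + 2) c21 c21s)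
    (fun M : GL (Fin 2) F => substX M.val)
    (fun M c hcx => dicksonAlgebra_le_xInvariants hF hc hcs hcx M) (u0 F) substX_u0_injective
    ?_ (pairingMonomial k (u0 F) (u1 F (k + 2)) (u1s F (k + 2)))
    (fun n => mem_span_pairingMonomial hF hc hcs
      (pow_mem (Algebra.subset_adjoin (by simp)) n)) a ha h0
  rw [← Nat.card_eq_fintype_card (α := GL (Fin 2) F), card_GL_two hF]
  simp only [Fintype.card_sum, Fintype.card_prod, Fintype.card_fin]
  rw [show (k + 2) ^ 2 - 1 = (k + 1) * (k + 3) by rw [Nat.sub_eq_iff_eq_add (by nlinarith)]; ring,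
    show (k + 2) ^ 2 - (k + 2) = (k + 1) * (k + 2) by
      rw [Nat.sub_eq_iff_eq_add (by nlinarith)]; ring]
  ring

theorem isRelPrime_d22_d22s (hF : Fintype.card F = q) : IsRelPrime (d22 F q) (d22s F q) := by
  have key : ∀ {p f : R2 F} (i : Fin 4), p ∣ f → f ≠ 0 → degreeOf i f = 0 → degreeOf i p = 0 := by
    rintro p _ i ⟨g, rfl⟩ h0 h
    rw [degreeOf_mul_eq (left_ne_zero_of_mul h0) (right_ne_zero_of_mul h0)] at h
    omega
  intro p hp hps
  obtain ⟨a, rfl⟩ : ∃ a, p = C a := eq_C_of_degreeOf_eq_zero fun i => by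
    by_cases hi : i = 0 ∨ i = 1
    · refine key i hps (d22s_ne_zero hF) (degreeOf_d22s q i ?_ ?_) <;> rintro rfl <;> simp at hi
    · rw [not_or] at hi
      exact key i hp (d22_ne_zero hF) (degreeOf_d22 q i hi.1 hi.2)
  refine (IsUnit.mk0 a ?_).map C
  rintro rfl
  rw [C_0, zero_dvd_iff] at hp
  exact d22_ne_zero hF hp

theorem revHom_mem_adjoin (hF : Fintype.card F = q)
    (hc : d22 F q * c21 = X 1 * X 0 ^ (q ^ 2) - X 0 * X 1 ^ (q ^ 2))
    (hcs : d22s F q * c21s = X 2 * X 3 ^ (q ^ 2) - X 3 * X 2 ^ (q ^ 2))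
    {f : R2 F} (hf : f ∈ Algebra.adjoin F {d22 F q ^ (q - 1), c21, u0 F, u1 F q}) :
    revHom F f ∈ Algebra.adjoin F {d22s F q ^ (q - 1), c21s, u0 F, u1s F q} := by
  have h : revHom F f ∈ (Algebra.adjoin F {d22 F q ^ (q - 1), c21, u0 F, u1 F q}).map
    (revHom F) := ⟨f, hf, rfl⟩
  rw [AlgHom.map_adjoin] at h
  refine Algebra.adjoin_mono ?_ h
  rintro _ ⟨_, rfl | rfl | rfl | rfl, rfl⟩ <;> simp [revHom_c21 hF hc hcs]

theorem mem_adjoin_of_mem_invariantRing {k : ℕ} (hF : Fintype.card F = k + 2)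
    (hc : d22 F (k + 2) * c21 = X 1 * X 0 ^ ((k + 2) ^ 2) - X 0 * X 1 ^ ((k + 2) ^ 2))
    (hcs : d22s F (k + 2) * c21s = X 2 * X 3 ^ ((k + 2) ^ 2) - X 3 * X 2 ^ ((k + 2) ^ 2))
    {f : R2 F} (hf : f ∈ invariantRing (⊤ : Subgroup (GL (Fin 2) F))) :
    f ∈ Algebra.adjoin F {d22 F (k + 2) ^ (k + 1), c21, d22s F (k + 2) ^ (k + 1),
      c21s, u1s F (k + 2), u0 F, u1 F (k + 2)} := by
  set B : Subalgebra F (R2 F) := Algebra.adjoin F {d22 F (k + 2) ^ (k + 1), c21,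
    d22s F (k + 2) ^ (k + 1), c21s, u1s F (k + 2), u0 F, u1 F (k + 2)}
  set e := d22 F (k + 2) ^ (k + 1)
  set es := d22s F (k + 2) ^ (k + 1)
  have he0 : e ≠ 0 := pow_ne_zero _ (d22_ne_zero hF)
  have hes0 : es ≠ 0 := pow_ne_zero _ (d22s_ne_zero hF)
  let A := dicksonAlgebra (k + 2) c21 c21s
  have heA : e ∈ A := Algebra.subset_adjoin (Or.inl rfl)
  have hesA : es ∈ A := Algebra.subset_adjoin (Or.inr (Or.inr (Or.inl rfl)))
  have hAB : A ≤ B := by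
    refine Algebra.adjoin_mono ?_
    rintro _ (rfl | rfl | rfl | rfl) <;> simp
  obtain ⟨m, hm⟩ : ∃ m, e ^ m * f ∈ B := by
    obtain ⟨m, hm⟩ := exists_pow_mul_mem_adjoin hF hc hf
    refine ⟨m, Algebra.adjoin_mono ?_ hm⟩
    rintro _ (rfl | rfl | rfl | rfl) <;> simp
  obtain ⟨n, hn⟩ : ∃ n, es ^ n * f ∈ B := by
    obtain ⟨n, hn⟩ := exists_pow_mul_mem_adjoin hF hc (revHom_mem_invariantRing hf)
    have h := revHom_mem_adjoin hF hc hcs hn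
    rw [map_mul, revHom_revHom, map_pow, map_pow, revHom_d22] at h
    refine ⟨n, Algebra.adjoin_mono ?_ h⟩
    rintro _ (rfl | rfl | rfl | rfl) <;> simp
  obtain ⟨a, ha⟩ := (Submodule.mem_span_range_iff_exists_fun A).1
    (mem_span_pairingMonomial hF hc hcs hm)
  obtain ⟨b, hb⟩ := (Submodule.mem_span_range_iff_exists_fun A).1
    (mem_span_pairingMonomial hF hc hcs hn)
  set mon := pairingMonomial k (u0 F) (u1 F (k + 2)) (u1s F (k + 2)) with hmon
  replace ha : ∑ i, (a i : R2 F) * mon i = e ^ m * f := ha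
  replace hb : ∑ i, (b i : R2 F) * mon i = es ^ n * f := hb
  have hab : ∀ i, es ^ n * a i = e ^ m * b i := fun i => by
    refine sub_eq_zero.1 (eq_zero_of_sum_mul_pairingMonomial_eq_zero hF hc hcs
      (fun i => es ^ n * a i - e ^ m * b i)
      (fun i => sub_mem (mul_mem (pow_mem hesA n) (a i).2) (mul_mem (pow_mem heA m) (b i).2))
      ?_ i)
    simp only [sub_mul, Finset.sum_sub_distrib, mul_assoc, ← Finset.mul_sum]
    rw [← hmon, ha, hb]
    ring
  have hrel : IsRelPrime (e ^ m) (es ^ n) := (isRelPrime_d22_d22s hF).pow.pow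
  have hdvd : ∀ i, e ^ m ∣ a i := fun i => hrel.dvd_of_dvd_mul_left ⟨b i, hab i⟩
  choose r hr using hdvd
  have hrA : ∀ i, r i ∈ A := by
    intro i
    have hre : e ^ m * r i ∈ A := hr i ▸ (a i).2
    refine mem_dicksonAlgebra hF hc hcs (fun M => ?_) (fun M => ?_)
    · apply mul_left_cancel₀ (pow_ne_zero m he0)
      nth_rewrite 1 [← dicksonAlgebra_le_xInvariants hF hc hcs (pow_mem heA m) M]
      rw [← map_mul]
      exact dicksonAlgebra_le_xInvariants hF hc hcs hre M
    · have h1 : substX M.val (revHom F (e ^ m)) = revHom F (e ^ m) :=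
        dicksonAlgebra_le_yInvariants hF hc hcs (pow_mem heA m) M
      have h2 : substX M.val (revHom F (e ^ m * r i)) = revHom F (e ^ m * r i) :=
        dicksonAlgebra_le_yInvariants hF hc hcs hre M
      apply mul_left_cancel₀ ((map_ne_zero_iff _ revHom_injective).2 (pow_ne_zero m he0))
      rwa [map_mul, map_mul, h1] at h2
  have hfr : f = ∑ i, r i * mon i := by
    apply mul_left_cancel₀ (pow_ne_zero m he0)
    rw [← ha, Finset.mul_sum]
    exact Finset.sum_congr rfl fun i _ => by rw [hr, mul_assoc]
  have hu : u0 F ∈ B := Algebra.subset_adjoin (by simp)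
  have hv : u1 F (k + 2) ∈ B := Algebra.subset_adjoin (by simp)
  have hw : u1s F (k + 2) ∈ B := Algebra.subset_adjoin (by simp)
  rw [hfr]
  refine sum_mem fun i _ => mul_mem (hAB (hrA i)) ?_
  rcases i with i | i
  · exact mul_mem (mul_mem (pow_mem hu _) (pow_mem hv _)) (pow_mem hw _)
  · exact pow_mem hu _

end Generation

/-- `R₂^{GL₂(F_q)}` is generated as an `F_q`-algebra by
`{d₂₂^{q−1}, c₂₁, (d₂₂*)^{q−1}, c₂₁*, u₁*, u₀, u₁}`. -/
theorem stmt_16 (q : ℕ) (hq : IsPrimePow q) (F : Type) [Field F] [Fintype F]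
    (hF : Fintype.card F = q)
    (c21 c21s : R2 F)
    (hc21 : d22 F q * c21 = X 1 * X 0 ^ (q ^ 2) - X 0 * X 1 ^ (q ^ 2))
    (hc21s : d22s F q * c21s = X 2 * X 3 ^ (q ^ 2) - X 3 * X 2 ^ (q ^ 2)) :
    invariantRing (⊤ : Subgroup (GL (Fin 2) F)) =
      Algebra.adjoin F
        {d22 F q ^ (q - 1), c21, d22s F q ^ (q - 1), c21s, u1s F q, u0 F, u1 F q} := by
  refine le_antisymm ?_ (adjoin_le_invariantRing hF hc21 hc21s)
  obtain ⟨k, rfl⟩ := Nat.exists_eq_add_of_le' (two_le_of_card hF)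
  exact fun f hf => mem_adjoin_of_mem_invariantRing hF hc21 hc21s hf
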